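/- Under Assumptions 1, 2, 3 and 4, suppose that E_∞ has a unique minimizer u_∞ over T_∞ and that for every σ ∈ (0,∞) and h ∈ (0,h0] the functional E_σ has a unique minimizer u_{σ,h} over W_{σ,h}. Then the discrete approximations are asymptotically compatible: for all sequences σ_n → ∞ and h_n → 0, ‖u_{σ_n,h_n} − u_∞‖_{T0} → 0 as n → ∞. -/

import Mathlib

open Filter Topology ENNReal

noncomputable section

variable {T0 : Type*} [NormedAddCommGroup T0] [NormedSpace ℝ T0] [CompleteSpace T0]

/-- Weak convergence of a sequence lying in the subspace `S ⊆ T0` endowed with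
the norm `N`, tested against all linear functionals on `T0` which are bounded on
`(S, N)`. -/
def WeakConvIn (S : Set T0) (N : T0 → ℝ) (v : ℕ → T0) (v0 : T0) : Prop :=
  ∀ f : T0 →ₗ[ℝ] ℝ, (∃ C : ℝ, ∀ u ∈ S, |f u| ≤ C * N u) →
    Tendsto (fun n => f (v n)) atTop (𝓝 (f v0))

/-- `(S, N)` is a linear subspace of `T0` on which `N` is a norm. -/
structure IsNormedSubspace (S : Set T0) (N : T0 → ℝ) : Prop where
  zero_mem : (0 : T0) ∈ S
  add_mem : ∀ u v : T0, u ∈ S → v ∈ S → u + v ∈ S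
  smul_mem : ∀ (c : ℝ) (u : T0), u ∈ S → c • u ∈ S
  nonneg : ∀ u ∈ S, 0 ≤ N u
  eq_zero_of : ∀ u ∈ S, N u = 0 → u = 0
  triangle : ∀ u ∈ S, ∀ v ∈ S, N (u + v) ≤ N u + N v
  norm_smul : ∀ (c : ℝ), ∀ u ∈ S, N (c • u) = |c| * N u

/-- The weak sequential compactness of norm-bounded sets, i.e. the property of a
reflexive Banach space furnished by the Banach–Alaoglu/Eberlein–Šmulian theorems. -/
def WeakSeqCompactIn (S : Set T0) (N : T0 → ℝ) : Prop :=
  ∀ v : ℕ → T0, (∀ n, v n ∈ S) → (∃ C : ℝ, ∀ n, N (v n) ≤ C) →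
    ∃ (w : T0) (φ : ℕ → ℕ), w ∈ S ∧ StrictMono φ ∧ WeakConvIn S N (v ∘ φ) w

/-- Extension `Ē` of an energy `E` defined on `S ⊆ T0` to all of `T0`, taking the
value `+∞` off `S`. -/
def Ebar (S : Set T0) (E : T0 → ℝ) (u : T0) : ℝ≥0∞ :=
  haveI := Classical.dec (u ∈ S)
  if u ∈ S then ENNReal.ofReal (E u) else ⊤

/-- A sequence of (finite) parameters `σ_n ∈ (0,∞)` tending to `∞`. -/
def ToInf (σs : ℕ → ℝ≥0∞) : Prop :=
  (∀ n, 0 < σs n ∧ σs n ≠ ⊤) ∧ Tendsto σs atTop (𝓝 ⊤)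

/-- The data of the parametrized family: for each `σ ∈ (0,∞]` (encoded in `ℝ≥0∞`,
with `σ = ⊤` corresponding to `σ = ∞`), the subspace `T_σ = S σ ⊆ T0`, its norm
`‖·‖_{T_σ} = N σ`, and the energy `E_σ = E σ`. -/
structure Family (T0 : Type*) [NormedAddCommGroup T0] [NormedSpace ℝ T0] where
  S : ℝ≥0∞ → Set T0
  N : ℝ≥0∞ → T0 → ℝ
  E : ℝ≥0∞ → T0 → ℝ

namespace Family

variable (F : Family T0)

/-- Standing structural assumptions: for every `σ ∈ (0,∞]`, `(T_σ, ‖·‖_{T_σ})` is a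
normed linear subspace of `T0` which is weakly sequentially compact on bounded sets
(the property of reflexive Banach spaces), and `E_σ : T_σ → [0,∞)` is sequentially
lower semicontinuous with respect to weak convergence in `T_σ`. -/
structure Basic : Prop where
  normed : ∀ σ : ℝ≥0∞, 0 < σ → IsNormedSubspace (F.S σ) (F.N σ)
  reflexive : ∀ σ : ℝ≥0∞, 0 < σ → WeakSeqCompactIn (F.S σ) (F.N σ)
  nonneg : ∀ σ : ℝ≥0∞, 0 < σ → ∀ u ∈ F.S σ, 0 ≤ F.E σ u
  lsc : ∀ σ : ℝ≥0∞, 0 < σ → ∀ (v : ℕ → T0) (v0 : T0), (∀ n, v n ∈ F.S σ) →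
    v0 ∈ F.S σ → WeakConvIn (F.S σ) (F.N σ) v v0 →
    ENNReal.ofReal (F.E σ v0) ≤ Filter.liminf (fun n => ENNReal.ofReal (F.E σ (v n))) atTop

/-- Assumption 1: uniform embedding of the `T_σ` into `T0`, and asymptotic
compactness of uniformly bounded sequences, with limit points in `T_∞`. -/
structure A1 : Prop where
  embed : ∃ M1 : ℝ, 0 < M1 ∧ ∀ σ : ℝ≥0∞, 0 < σ → ∀ u ∈ F.S σ, M1 * ‖u‖ ≤ F.N σ u
  compact : ∀ σs : ℕ → ℝ≥0∞, ToInf σs → ∀ v : ℕ → T0, (∀ n, v n ∈ F.S (σs n)) →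
    (∃ C : ℝ, ∀ n, F.N (σs n) (v n) ≤ C) →
    ((∃ (w : T0) (φ : ℕ → ℕ), StrictMono φ ∧
        Tendsto (fun n => v (φ n)) atTop (𝓝 w)) ∧
      ∀ (w : T0) (φ : ℕ → ℕ), StrictMono φ →
        Tendsto (fun n => v (φ n)) atTop (𝓝 w) → w ∈ F.S ⊤)

/-- Assumption 2: continuity and coercivity of the energies, uniformly in `σ`. -/
structure A2 (p : ℝ) : Prop where
  continuity : ∃ φ : ℝ → ℝ → ℝ, Continuous (Function.uncurry φ) ∧
    ∀ σ : ℝ≥0∞, 0 < σ → ∀ u ∈ F.S σ, ∀ v ∈ F.S σ,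
      |F.E σ u - F.E σ v| ≤ φ (F.N σ u) (F.N σ v) * F.N σ (u - v)
  coercive : ∃ α : ℝ, 0 < α ∧ ∃ ψ : ℝ → ℝ, Continuous ψ ∧
    Tendsto (fun t => ψ t / t ^ p) atTop (𝓝 0) ∧
    ∀ σ : ℝ≥0∞, 0 < σ → ∀ u ∈ F.S σ, α * F.N σ u ^ p ≤ F.E σ u + ψ (F.N σ u)

/-- Assumption 3: Γ-convergence, in the strong topology of `T0`, of the extended
energies `Ē_σ` to `Ē_∞` as `σ → ∞`. -/
structure A3 : Prop where
  liminf_le : ∀ (v : T0) (σs : ℕ → ℝ≥0∞), ToInf σs → ∀ vs : ℕ → T0,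
    Tendsto vs atTop (𝓝 v) →
    Ebar (F.S ⊤) (F.E ⊤) v ≤ Filter.liminf (fun n => Ebar (F.S (σs n)) (F.E (σs n)) (vs n)) atTop
  recovery : ∀ (v : T0) (σs : ℕ → ℝ≥0∞), ToInf σs →
    ∃ vs : ℕ → T0, Tendsto vs atTop (𝓝 v) ∧
      Filter.limsup (fun n => Ebar (F.S (σs n)) (F.E (σs n)) (vs n)) atTop ≤
        Ebar (F.S ⊤) (F.E ⊤) v

/-- Structural assumptions on the finite-dimensional (Galerkin) subspaces
`W_{σ,h} ⊆ T_σ`, for `σ ∈ (0,∞]` and `h ∈ (0,h0]`: each is a linear subspace,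
and for each `h` the span of `⋃_{σ ∈ (0,∞]} W_{σ,h}` is finite dimensional. -/
structure FEBasic (W : ℝ≥0∞ → ℝ → Set T0) (h0 : ℝ) : Prop where
  h0_pos : 0 < h0
  subset : ∀ σ : ℝ≥0∞, 0 < σ → ∀ h ∈ Set.Ioc (0 : ℝ) h0, W σ h ⊆ F.S σ
  linear : ∀ σ : ℝ≥0∞, 0 < σ → ∀ h ∈ Set.Ioc (0 : ℝ) h0,
    (0 : T0) ∈ W σ h ∧ (∀ u ∈ W σ h, ∀ v ∈ W σ h, u + v ∈ W σ h) ∧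
      ∀ (c : ℝ), ∀ u ∈ W σ h, c • u ∈ W σ h
  findim : ∀ h ∈ Set.Ioc (0 : ℝ) h0,
    FiniteDimensional ℝ (Submodule.span ℝ (⋃ σ ∈ Set.Ioi (0 : ℝ≥0∞), W σ h))

/-- Assumption 4: approximation property of the subspaces `W_{σ,h}`, the
characterization of the limiting spaces `W_{∞,h}`, and the asymptotic
approximability of recovery sequences. -/
structure A4 (W : ℝ≥0∞ → ℝ → Set T0) (h0 : ℝ) : Prop where
  approx : ∀ σ : ℝ≥0∞, 0 < σ → ∀ u ∈ F.S σ, ∃ (hs : ℕ → ℝ) (us : ℕ → T0),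
    (∀ n, hs n ∈ Set.Ioc (0 : ℝ) h0) ∧ Tendsto hs atTop (𝓝 0) ∧
    (∀ n, us n ∈ W σ (hs n)) ∧ Tendsto (fun n => F.N σ (u - us n)) atTop (𝓝 0)
  limitSpace : ∀ h ∈ Set.Ioc (0 : ℝ) h0,
    W ⊤ h = F.S ⊤ ∩ ⋃ σ ∈ Set.Ioi (0 : ℝ≥0∞), W σ h
  asympApprox_pos : ∀ h ∈ Set.Ioc (0 : ℝ) h0, ∀ v ∈ W ⊤ h,
    ∀ σs : ℕ → ℝ≥0∞, ToInf σs →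
    ∃ vs : ℕ → T0, (∀ n, vs n ∈ F.S (σs n)) ∧ Tendsto vs atTop (𝓝 v) ∧
      Tendsto (fun n => F.E (σs n) (vs n)) atTop (𝓝 (F.E ⊤ v)) ∧
      ∃ ws : ℕ → T0, (∀ n, ws n ∈ W (σs n) h) ∧
        Tendsto (fun n => F.N (σs n) (ws n - vs n)) atTop (𝓝 0)
  asympApprox_zero : ∀ v ∈ F.S ⊤, ∀ (σs : ℕ → ℝ≥0∞) (hs : ℕ → ℝ), ToInf σs →
    (∀ n, hs n ∈ Set.Ioc (0 : ℝ) h0) → Tendsto hs atTop (𝓝 0) →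
    ∃ vs : ℕ → T0, (∀ n, vs n ∈ F.S (σs n)) ∧ Tendsto vs atTop (𝓝 v) ∧
      Tendsto (fun n => F.E (σs n) (vs n)) atTop (𝓝 (F.E ⊤ v)) ∧
      ∃ ws : ℕ → T0, (∀ n, ws n ∈ W (σs n) (hs n)) ∧
        Tendsto (fun n => F.N (σs n) (ws n - vs n)) atTop (𝓝 0)

end Family

/-- A quantity `t` whose `p`-th power is controlled by `C + ψ t` with `ψ` of lower order
than `t ^ p` is bounded. -/
theorem exists_bound_of_coercive {p α : ℝ} (hp : 0 < p) (hα : 0 < α) {ψ : ℝ → ℝ}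
    (hψ : Tendsto (fun t => ψ t / t ^ p) atTop (𝓝 0)) (C : ℝ) :
    ∃ B : ℝ, ∀ t : ℝ, α * t ^ p ≤ C + ψ t → t ≤ B := by
  have hsmall : ∀ᶠ t in atTop, ψ t / t ^ p < α / 2 :=
    hψ.eventually (gt_mem_nhds (half_pos hα))
  have hlarge : ∀ᶠ t : ℝ in atTop, 2 * C / α < t ^ p :=
    (tendsto_rpow_atTop hp).eventually_gt_atTop _
  obtain ⟨B, hBd⟩ := eventually_atTop.1 (hsmall.and (hlarge.and (eventually_gt_atTop 0)))
  refine ⟨B, fun t ht => ?_⟩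
  by_contra! hlt
  obtain ⟨hψt, hCt, ht0⟩ := hBd t hlt.le
  rw [div_lt_iff₀ (Real.rpow_pos_of_pos ht0 p)] at hψt
  rw [div_lt_iff₀ hα] at hCt
  nlinarith

theorem ToInf.comp {σs : ℕ → ℝ≥0∞} (hσ : ToInf σs) {ns : ℕ → ℕ}
    (hns : Tendsto ns atTop atTop) : ToInf (σs ∘ ns) :=
  ⟨fun n => hσ.1 (ns n), hσ.2.comp hns⟩

namespace Family

variable {V : Type*} [NormedAddCommGroup V] [NormedSpace ℝ V] {F : Family V}

/-- Energy bounds imply norm bounds, uniformly in `σ`. -/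
theorem A2.exists_norm_bound {p : ℝ} (h2 : F.A2 p) (hp : 0 < p) (C : ℝ) :
    ∃ B : ℝ, ∀ σ : ℝ≥0∞, 0 < σ → ∀ u ∈ F.S σ, F.E σ u ≤ C → F.N σ u ≤ B := by
  obtain ⟨α, hα, ψ, -, hψ, hcoer⟩ := h2.coercive
  obtain ⟨B, hBd⟩ := exists_bound_of_coercive hp hα hψ C
  exact ⟨B, fun σ hσ u hu hE => hBd _ ((hcoer σ hσ u hu).trans (by gcongr))⟩

/-- Perturbations which vanish in the norms `‖·‖_{T_σ}` do not change the limit of the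
energies along a norm-bounded sequence. -/
theorem A2.tendsto_energy_of_norm_sub {p : ℝ} (h2 : F.A2 p) (hB : F.Basic)
    {σs : ℕ → ℝ≥0∞} (hσ : ∀ n, 0 < σs n) {vs ws : ℕ → V} (hvs : ∀ n, vs n ∈ F.S (σs n))
    (hws : ∀ n, ws n ∈ F.S (σs n)) {B e : ℝ} (hvB : ∀ n, F.N (σs n) (vs n) ≤ B)
    (hE : Tendsto (fun n => F.E (σs n) (vs n)) atTop (𝓝 e))
    (hsub : Tendsto (fun n => F.N (σs n) (ws n - vs n)) atTop (𝓝 0)) :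
    Tendsto (fun n => F.E (σs n) (ws n)) atTop (𝓝 e) := by
  obtain ⟨φ, hφ, hcont⟩ := h2.continuity
  have hmem : ∀ n, ws n - vs n ∈ F.S (σs n) := fun n => by
    have hS := hB.normed _ (hσ n)
    simpa [sub_eq_add_neg] using hS.add_mem _ _ (hws n) (hS.smul_mem (-1) _ (hvs n))
  obtain ⟨D, hD⟩ := hsub.bddAbove_range
  have hwB : ∀ n, F.N (σs n) (ws n) ≤ D + B := fun n => by
    have htri := (hB.normed _ (hσ n)).triangle _ (hmem n) _ (hvs n)
    rw [sub_add_cancel] at htri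
    exact htri.trans (add_le_add (hD (Set.mem_range_self n)) (hvB n))
  obtain ⟨K, hK⟩ := ((isCompact_Icc (a := (0 : ℝ)) (b := D + B)).prod
    (isCompact_Icc (a := (0 : ℝ)) (b := B))).bddAbove_image hφ.continuousOn
  have hbound : ∀ n, |F.E (σs n) (ws n) - F.E (σs n) (vs n)| ≤
      K * F.N (σs n) (ws n - vs n) := fun n => by
    have hS := hB.normed _ (hσ n)
    refine (hcont _ (hσ n) _ (hws n) _ (hvs n)).trans
      (mul_le_mul_of_nonneg_right ?_ (hS.nonneg _ (hmem n)))
    exact hK ⟨(F.N (σs n) (ws n), F.N (σs n) (vs n)),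
      ⟨⟨hS.nonneg _ (hws n), hwB n⟩, ⟨hS.nonneg _ (hvs n), hvB n⟩⟩, rfl⟩
  have hdiff : Tendsto (fun n => F.E (σs n) (ws n) - F.E (σs n) (vs n)) atTop (𝓝 0) :=
    squeeze_zero_norm hbound (by simpa using hsub.const_mul K)
  simpa using hdiff.add hE

/-- A sequence whose energies are dominated by energies converging to the minimum of `E_∞`
has a subsequence converging to a minimizer of `E_∞`. -/
theorem exists_subseq_tendsto_minimizer {p : ℝ} (hp : 0 < p) (hB : F.Basic) (h1 : F.A1)
    (h2 : F.A2 p) (h3 : F.A3) {uinf : V} (huinf : uinf ∈ F.S ⊤)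
    (hmin : ∀ v ∈ F.S ⊤, F.E ⊤ uinf ≤ F.E ⊤ v) {σs : ℕ → ℝ≥0∞} (hσ : ToInf σs)
    {us : ℕ → V} (hus : ∀ n, us n ∈ F.S (σs n)) {es : ℕ → ℝ}
    (hle : ∀ n, F.E (σs n) (us n) ≤ es n) (hes : Tendsto es atTop (𝓝 (F.E ⊤ uinf))) :
    ∃ w ∈ F.S ⊤, (∀ v ∈ F.S ⊤, F.E ⊤ w ≤ F.E ⊤ v) ∧
      ∃ φ : ℕ → ℕ, StrictMono φ ∧ Tendsto (fun n => us (φ n)) atTop (𝓝 w) := by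
  obtain ⟨C, hC⟩ := hes.bddAbove_range
  obtain ⟨B, hBd⟩ := h2.exists_norm_bound hp C
  obtain ⟨⟨w, φ, hφ, hw⟩, hlim⟩ := h1.compact σs hσ us hus
    ⟨B, fun n => hBd _ (hσ.1 n).1 _ (hus n) ((hle n).trans (hC (Set.mem_range_self n)))⟩
  have hwS : w ∈ F.S ⊤ := hlim w φ hφ hw
  refine ⟨w, hwS, fun v hv => le_trans ?_ (hmin v hv), φ, hφ, hw⟩
  have hes' : Tendsto (fun n => ENNReal.ofReal (es (φ n))) atTop
      (𝓝 (ENNReal.ofReal (F.E ⊤ uinf))) :=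
    (ENNReal.continuous_ofReal.tendsto _).comp (hes.comp hφ.tendsto_atTop)
  have hliminf := h3.liminf_le w _ (hσ.comp hφ.tendsto_atTop) _ hw
  have hup : liminf (fun n => Ebar (F.S ((σs ∘ φ) n)) (F.E ((σs ∘ φ) n)) (us (φ n))) atTop ≤
      ENNReal.ofReal (F.E ⊤ uinf) := by
    rw [← hes'.liminf_eq]
    refine liminf_le_liminf (Eventually.of_forall fun n => ?_)
    simpa [Ebar, hus] using ENNReal.ofReal_le_ofReal (hle (φ n))
  have hfinal := hliminf.trans hup
  simp only [Ebar, hwS, if_true] at hfinal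
  exact (ENNReal.ofReal_le_ofReal_iff (hB.nonneg ⊤ (by simp) _ huinf)).1 hfinal

end Family

/-- Proposition 2.10(3), asymptotic compatibility: under
Assumptions 1, 2, 3 and 4, if `E_∞` has a unique minimizer `u_∞` over `T_∞` and
`E_σ` has a unique minimizer `u_{σ,h}` over `W_{σ,h}` for every `σ ∈ (0,∞)` and
`h ∈ (0,h0]`, then for all sequences `σ_n → ∞` and `h_n → 0`,
`‖u_{σ_n,h_n} − u_∞‖_{T_0} → 0`. -/
theorem asymptotic_compatibility_of_discrete_minimizers
    {T0 : Type*} [NormedAddCommGroup T0] [NormedSpace ℝ T0] [CompleteSpace T0]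
    (F : Family T0) (W : ℝ≥0∞ → ℝ → Set T0) (p h0 : ℝ) (hp : 1 < p)
    (hB : F.Basic) (h1 : F.A1) (h2 : F.A2 p) (h3 : F.A3)
    (hFE : F.FEBasic W h0) (h4 : F.A4 W h0)
    (uinf : T0)
    (huinf : uinf ∈ F.S ⊤ ∧ (∀ v ∈ F.S ⊤, F.E ⊤ uinf ≤ F.E ⊤ v) ∧
      ∀ w ∈ F.S ⊤, (∀ v ∈ F.S ⊤, F.E ⊤ w ≤ F.E ⊤ v) → w = uinf)
    (u : ℝ≥0∞ → ℝ → T0)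
    (hu : ∀ σ : ℝ≥0∞, 0 < σ → σ ≠ ⊤ → ∀ h ∈ Set.Ioc (0 : ℝ) h0,
      u σ h ∈ W σ h ∧ (∀ v ∈ W σ h, F.E σ (u σ h) ≤ F.E σ v) ∧
      ∀ w ∈ W σ h, (∀ v ∈ W σ h, F.E σ w ≤ F.E σ v) → w = u σ h) :
    ∀ (σs : ℕ → ℝ≥0∞) (hs : ℕ → ℝ), ToInf σs →
      (∀ n, hs n ∈ Set.Ioc (0 : ℝ) h0) → Tendsto hs atTop (𝓝 0) →
      Tendsto (fun n => u (σs n) (hs n)) atTop (𝓝 uinf) := by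
  intro σs hs hσ hh hh0
  have hp0 : 0 < p := one_pos.trans hp
  refine tendsto_of_subseq_tendsto fun ns hns => ?_
  have hσ' := hσ.comp hns
  obtain ⟨vs, hvs, -, hvE, ws, hws, hsub⟩ := h4.asympApprox_zero uinf huinf.1 (σs ∘ ns)
    (hs ∘ ns) hσ' (fun n => hh (ns n)) (hh0.comp hns)
  obtain ⟨C, hC⟩ := hvE.bddAbove_range
  obtain ⟨B, hBd⟩ := h2.exists_norm_bound hp0 C
  have hwE := h2.tendsto_energy_of_norm_sub hB (fun n => (hσ'.1 n).1) hvs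
    (fun n => hFE.subset _ (hσ'.1 n).1 _ (hh (ns n)) (hws n))
    (fun n => hBd _ (hσ'.1 n).1 _ (hvs n) (hC (Set.mem_range_self n))) hvE hsub
  have hun := fun n => hu _ (hσ'.1 n).1 (hσ'.1 n).2 _ (hh (ns n))
  obtain ⟨w, hwS, hwmin, φ, -, hφ⟩ := Family.exists_subseq_tendsto_minimizer hp0 hB h1 h2 h3
    huinf.1 huinf.2.1 hσ' (fun n => hFE.subset _ (hσ'.1 n).1 _ (hh (ns n)) (hun n).1)
    (fun n => (hun n).2.1 _ (hws n)) hwE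
  rw [huinf.2.2 w hwS hwmin] at hφ
  exact ⟨φ, hφ⟩
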